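/- arXiv:0910.5761 — 2 statements merged into one kernel-verified Lean document; each statement's English description precedes it below -/
import Mathlib

section
/- There exists a numerical constant K such that the following holds: for every Δ > 3 and every θ > K/Δ, there exist finite simple graphs G of maximum degree at most Δ (on arbitrarily many vertices) and a constant δ₀ > 0 such that for every threshold τ and every sample size n, the probability that the thresholding algorithm Thr(τ) applied to n i.i.d. samples from μ_{G,θ} outputs exactly G is at most 1 − δ₀; i.e., the thresholding algorithm fails with probability bounded away from zero for all n and all τ. -/
open Finset Real Filter

noncomputable section

/-- The spin value (±1) associated to a Boolean. -/
def spin (b : Bool) : ℝ := if b then 1 else -1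

open scoped Classical in
/-- The (unnormalized) Ising weight of a configuration `x : Fin p → Bool`:
`∏_{(i,j) ∈ E} exp (θ x_i x_j)`. -/
def isingWeight {p : ℕ} (G : SimpleGraph (Fin p)) (θ : ℝ) (x : Fin p → Bool) : ℝ :=
  ∏ e ∈ G.edgeFinset,
    Sym2.lift ⟨fun i j => Real.exp (θ * spin (x i) * spin (x j)),
      fun i j => by show rexp _ = rexp _; rw [mul_right_comm]⟩ e

/-- The Ising probability `μ_{G,θ}(x)` of a single configuration. -/
def isingProb {p : ℕ} (G : SimpleGraph (Fin p)) (θ : ℝ) (x : Fin p → Bool) : ℝ :=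
  isingWeight G θ x / ∑ y : Fin p → Bool, isingWeight G θ y

/-- Probability of an event `A` for `n` i.i.d. samples from `μ_{G,θ}`. -/
def sampleProb {p : ℕ} (G : SimpleGraph (Fin p)) (θ : ℝ) (n : ℕ)
    (A : Set (Fin n → Fin p → Bool)) : ℝ :=
  ∑ xs : Fin n → Fin p → Bool, A.indicator (fun _ => (1 : ℝ)) xs * ∏ ℓ, isingProb G θ (xs ℓ)

/-- Empirical correlation `Ĉ_{ij}` of the samples. -/
def empCorr {p n : ℕ} (xs : Fin n → Fin p → Bool) (i j : Fin p) : ℝ :=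
  (∑ ℓ, spin (xs ℓ i) * spin (xs ℓ j)) / n

/-- The graph output by the thresholding algorithm `Thr(τ)`. -/
def thrGraph {p n : ℕ} (xs : Fin n → Fin p → Bool) (τ : ℝ) : SimpleGraph (Fin p) :=
  SimpleGraph.fromRel (fun i j => τ ≤ empCorr xs i j)

/-- Inverse hyperbolic tangent. -/
def artanh (x : ℝ) : ℝ := Real.log ((1 + x) / (1 - x)) / 2

theorem sum_cons_aux {n : ℕ} (f : (Fin (n+1) → Bool) → ℝ) :
    ∑ x, f x = ∑ b : Bool, ∑ y : Fin n → Bool, f (Fin.cons b y) := by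
  rw [← Fintype.sum_prod_type']
  exact (Fintype.sum_equiv (Fin.consEquiv (fun _ => Bool)) _ _ (fun x => rfl)).symm

theorem sum_append_aux {k l : ℕ} (f : (Fin (k+l) → Bool) → ℝ) :
    ∑ x, f x = ∑ y : Fin k → Bool, ∑ z : Fin l → Bool, f (Fin.append y z) := by
  rw [← Fintype.sum_prod_type']
  exact (Fintype.sum_equiv (Fin.appendEquiv k l) _ _ (fun x => rfl)).symm

/-- middle vertices -/
def midV (m q : ℕ) (j : Fin m) : Fin (4 + (m + q)) := Fin.natAdd 4 (Fin.castAdd q j)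
/-- special vertices -/
def spV (m q : ℕ) (j : Fin 4) : Fin (4 + (m + q)) := Fin.castAdd (m+q) j

theorem midV_val (m q : ℕ) (j : Fin m) : (midV m q j).val = 4 + j.val := rfl
theorem spV_val (m q : ℕ) (j : Fin 4) : (spV m q j).val = j.val := rfl

/-- edges -/
def edgesS (m q : ℕ) : Finset (Sym2 (Fin (4 + (m + q)))) :=
  {s(spV m q 2, spV m q 3)} ∪
    (univ.image (fun j : Fin m => s(spV m q 0, midV m q j)) ∪
     univ.image (fun j : Fin m => s(spV m q 1, midV m q j)))

/-- the graph -/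
def theG (m q : ℕ) : SimpleGraph (Fin (4 + (m + q))) := SimpleGraph.fromEdgeSet (edgesS m q)

theorem mem_edgesS (m q : ℕ) (e) : e ∈ edgesS m q ↔ e = s(spV m q 2, spV m q 3) ∨
    (∃ j, s(spV m q 0, midV m q j) = e) ∨ (∃ j, s(spV m q 1, midV m q j) = e) := by
  simp [edgesS]

theorem edgesS_not_diag (m q : ℕ) (e) (h : e ∈ edgesS m q) : ¬ e.IsDiag := by
  rw [mem_edgesS] at h
  rcases h with rfl | ⟨j, rfl⟩ | ⟨j, rfl⟩ <;>
    simp [Sym2.mk_isDiag_iff, Fin.ext_iff, midV_val, spV_val] <;> omega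

theorem theG_edgeFinset (m q : ℕ) [Fintype (theG m q).edgeSet] :
    (theG m q).edgeFinset = edgesS m q := by
  ext e
  rw [SimpleGraph.mem_edgeFinset, theG, SimpleGraph.edgeSet_fromEdgeSet]
  constructor
  · intro h; exact h.1
  · intro h; exact ⟨h, edgesS_not_diag m q e h⟩

theorem theG_adj (m q : ℕ) (a b) : (theG m q).Adj a b ↔ s(a,b) ∈ edgesS m q := by
  rw [theG, SimpleGraph.fromEdgeSet_adj]
  constructor
  · intro h; exact h.1
  · intro h; exact ⟨h, fun hab => edgesS_not_diag m q _ h (by simpa using hab)⟩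

theorem theG_weight (m q : ℕ) (θ : ℝ) (x) : isingWeight (theG m q) θ x =
    rexp (θ * spin (x (spV m q 2)) * spin (x (spV m q 3))) *
    ∏ j, rexp (θ * (spin (x (spV m q 0)) + spin (x (spV m q 1))) * spin (x (midV m q j))) := by
  unfold isingWeight
  rw [theG_edgeFinset, edgesS, Finset.prod_union, Finset.prod_union, Finset.prod_image,
    Finset.prod_image, ← Finset.prod_mul_distrib]
  · simp only [Finset.prod_singleton, Sym2.lift_mk, ← Real.exp_add]
    congr 1
    refine Finset.prod_congr rfl fun j _ => ?_
    congr 1; ring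
  · intro a _ b _ h
    simp [Fin.ext_iff, midV_val, spV_val] at h
    exact Fin.ext (by omega)
  · intro a _ b _ h
    simp [Fin.ext_iff, midV_val, spV_val] at h
    exact Fin.ext (by omega)
  · rw [Finset.disjoint_left]
    simp [Fin.ext_iff, midV_val, spV_val]
  · rw [Finset.disjoint_left]
    simp [Fin.ext_iff, midV_val, spV_val]

theorem theG_sum (m q : ℕ) (θ : ℝ) (φ : Bool → Bool → Bool → Bool → ℝ) :
    ∑ x, isingWeight (theG m q) θ x *
      φ (x (spV m q 0)) (x (spV m q 1)) (x (spV m q 2)) (x (spV m q 3)) =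
    ∑ a, ∑ b, ∑ c, ∑ d, 2^q * (φ a b c d * rexp (θ * spin c * spin d) *
      (rexp (θ * (spin a + spin b)) + rexp (-(θ * (spin a + spin b))))^m) := by
  have key : ∀ y : Fin 4 → Bool, ∑ z : Fin (m+q) → Bool,
      isingWeight (theG m q) θ (Fin.append y z) *
      φ (Fin.append y z (spV m q 0)) (Fin.append y z (spV m q 1))
        (Fin.append y z (spV m q 2)) (Fin.append y z (spV m q 3)) =
      2^q * (φ (y 0) (y 1) (y 2) (y 3) * rexp (θ * spin (y 2) * spin (y 3)) *
      (rexp (θ * (spin (y 0) + spin (y 1))) + rexp (-(θ * (spin (y 0) + spin (y 1)))))^m) := by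
    intro y
    rw [sum_append_aux]
    simp only [theG_weight, spV, midV, Fin.append_left, Fin.append_right]
    simp only [Finset.sum_const, Finset.card_univ, Fintype.card_fun, Fintype.card_bool,
      Fintype.card_fin, nsmul_eq_mul]
    rw [← Finset.mul_sum, ← Finset.sum_mul, ← Finset.mul_sum]
    have := (Fintype.prod_sum (fun (_ : Fin m) (b : Bool) =>
      rexp (θ * (spin (y 0) + spin (y 1)) * spin b))).symm
    rw [this]
    simp only [Fintype.sum_bool, Finset.prod_const, Finset.card_univ, Fintype.card_fin]
    simp only [spin, if_true, Bool.false_eq_true, if_false, mul_one, mul_neg]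
    push_cast
    ring
  rw [sum_append_aux]
  simp only [key]
  rw [sum_cons_aux]; refine Finset.sum_congr rfl fun a _ => ?_
  rw [sum_cons_aux]; refine Finset.sum_congr rfl fun b _ => ?_
  rw [sum_cons_aux]; refine Finset.sum_congr rfl fun c _ => ?_
  rw [sum_cons_aux]; refine Finset.sum_congr rfl fun d _ => ?_
  rw [Fintype.sum_unique]
  rfl

theorem cosh_bound (m : ℕ) (hm : 3 < m) (u : ℝ) (hu : 4 / m < u) :
    rexp u < (Real.cosh u)^m := by
  have hm' : (4:ℝ) ≤ m := by exact_mod_cast hm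
  have hm0 : (0:ℝ) < m := by linarith
  have hu0 : 0 < u := lt_trans (by positivity) hu
  have hmu : 4 < m * u := by rw [div_lt_iff₀ hm0] at hu; linarith
  by_cases h1 : u < 1
  · have h2 : rexp (u^2/3) ≤ Real.cosh u := by
      have hc : 1 + u^2/2 ≤ Real.cosh u := by
        have h1 : Real.cosh u = 2 * Real.sinh (u/2)^2 + 1 := by
          have := Real.cosh_two_mul (u/2)
          rw [Real.cosh_sq, mul_div_cancel₀ _ (two_ne_zero)] at this
          linarith
        have h2 : u/2 ≤ Real.sinh (u/2) := Real.self_le_sinh_iff.2 (by linarith)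
        nlinarith
      have : 1 - u^2/3 ≤ rexp (-(u^2/3)) := by
        have := Real.add_one_le_exp (-(u^2/3)); linarith
      rw [Real.exp_neg] at this
      have hp := Real.exp_pos (u^2/3)
      have h3 : (1 - u^2/3) * rexp (u^2/3) ≤ 1 := by
        calc _ ≤ (rexp (u^2/3))⁻¹ * rexp (u^2/3) := by gcongr
          _ = 1 := inv_mul_cancel₀ hp.ne'
      have h4 : 1 ≤ (1 - u^2/3) * (1 + u^2/2) := by
        have hv : u^2 ≤ 1 := by nlinarith
        nlinarith [mul_nonneg (sq_nonneg u) (sub_nonneg.2 hv)]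
      have h5 : 0 < 1 - u^2/3 := by nlinarith
      have : rexp (u^2/3) ≤ 1 + u^2/2 := le_of_mul_le_mul_left (h3.trans h4) h5
      linarith
    calc rexp u < rexp (m * (u^2/3)) := by
          apply Real.exp_lt_exp.2; nlinarith
      _ = (rexp (u^2/3))^m := by rw [Real.exp_nat_mul]
      _ ≤ _ := by gcongr
  · push Not at h1
    have hc1 : 1 ≤ Real.cosh u := Real.one_le_cosh u
    have hc : rexp u / 2 ≤ Real.cosh u := by
      rw [Real.cosh_eq]; have := Real.exp_pos (-u); linarith
    have he : (2.7:ℝ) < rexp u := lt_of_lt_of_le (by have := Real.exp_one_gt_d9; linarith) (Real.exp_le_exp.2 h1)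
    calc rexp u < (rexp u / 2)^4 := by
          have : (2.7:ℝ)^3 < (rexp u)^3 := by gcongr
          have h16 : 16 < (rexp u)^3 := by norm_num at this; linarith
          nlinarith [Real.exp_pos u]
      _ ≤ Real.cosh u ^ 4 := by gcongr
      _ ≤ _ := pow_le_pow_right₀ hc1 hm

theorem weight_pos {p : ℕ} (G : SimpleGraph (Fin p)) (θ : ℝ) (x) : 0 < isingWeight G θ x := by
  unfold isingWeight
  refine Finset.prod_pos fun e _ => ?_
  induction e using Sym2.ind with
  | _ a b => exact Real.exp_pos _

theorem prob_nonneg {p : ℕ} (G : SimpleGraph (Fin p)) (θ : ℝ) (x) : 0 ≤ isingProb G θ x :=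
  div_nonneg (weight_pos G θ x).le (Finset.sum_nonneg fun y _ => (weight_pos G θ y).le)

theorem theG_exp (m q : ℕ) (hm : 3 < m) (θ : ℝ) (hθ : 2 / m < θ) : ∃ t : ℝ, 0 < t ∧
    ∑ x, isingProb (theG m q) θ x *
      rexp (t * (spin (x (spV m q 2)) * spin (x (spV m q 3))
        - spin (x (spV m q 0)) * spin (x (spV m q 1)))) < 1 := by
  have hc := cosh_bound m hm (2*θ) (by
    have : (4:ℝ)/m = 2 * (2/m) := by ring
    linarith)
  set A := rexp θ * 2^m with hA
  set B := rexp (-θ) * (2 * Real.cosh (2*θ))^m with hB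
  have hA0 : 0 < A := by positivity
  have hAB : A < B := by
    rw [hA, hB, mul_pow]
    have : rexp θ = rexp (-θ) * rexp (2*θ) := by rw [← Real.exp_add]; ring_nf
    rw [this]
    have h2 : (0:ℝ) < 2^m := by positivity
    have := mul_lt_mul_of_pos_left hc (mul_pos (Real.exp_pos (-θ)) h2)
    nlinarith
  obtain ⟨r, hr1, hr2⟩ := exists_between ((one_lt_div hA0).2 hAB)
  have hr0 : 0 < r := by linarith
  refine ⟨Real.log r / 2, by have := Real.log_pos hr1; positivity, ?_⟩
  have hZ : 0 < ∑ y, isingWeight (theG m q) θ y :=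
    Finset.sum_pos (fun y _ => weight_pos _ _ y) Finset.univ_nonempty
  unfold isingProb
  simp only [div_mul_eq_mul_div (isingWeight _ _ _)]
  rw [← Finset.sum_div, div_lt_one hZ]
  rw [theG_sum m q θ (fun a b c d => rexp (Real.log r / 2 * (spin c * spin d - spin a * spin b)))]
  have h1 := theG_sum m q θ (fun a b c d => 1)
  simp only [mul_one] at h1
  rw [h1]
  have er : rexp (Real.log r / 2 * (1 + 1)) = r := by
    rw [show Real.log r / 2 * (1+1) = Real.log r by ring, Real.exp_log hr0]
  have er' : rexp (Real.log r / 2 * (-1 - 1)) = r⁻¹ := by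
    rw [show Real.log r / 2 * (-1-1) = -Real.log r by ring, Real.exp_neg, Real.exp_log hr0]
  have ec : rexp (θ * (1+1)) + rexp (-(θ * (1+1))) = 2 * Real.cosh (2*θ) := by
    rw [Real.cosh_eq]; ring_nf
  have ec' : rexp (θ * (-1+-1)) + rexp (-(θ * (-1+-1))) = 2 * Real.cosh (2*θ) := by
    rw [Real.cosh_eq]; ring_nf
  have e2 : (rexp (θ * (1+-1)) + rexp (-(θ * (1+-1)))) = 2 := by norm_num
  have e2' : (rexp (θ * (-1+1)) + rexp (-(θ * (-1+1)))) = 2 := by norm_num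
  simp only [Fintype.sum_bool, spin, if_true, Bool.false_eq_true, if_false, ec, ec', e2, e2']
  simp only [mul_one, mul_neg, neg_neg, sub_neg_eq_add, sub_self, mul_zero, neg_mul,
    Real.exp_zero, one_mul, neg_add_cancel]
  have er2 : rexp (-(Real.log r / 2 * 1 + Real.log r / 2 * 1)) = r⁻¹ := by
    rw [← er']; ring_nf
  simp only [er, er']
  have hlt : A * r + B * r⁻¹ < A + B := by
    have h1 : A * r < B := by rwa [lt_div_iff₀ hA0, mul_comm] at hr2
    have : A + B - (A * r + B * r⁻¹) = (r - 1) * (B - A * r) / r := by field_simp; ring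
    have : 0 < (r - 1) * (B - A * r) / r :=
      div_pos (mul_pos (by linarith) (by linarith)) hr0
    linarith
  have h2q : (0:ℝ) < 2^q := by positivity
  have := mul_lt_mul_of_pos_left hlt h2q
  rw [hA, hB] at this
  nlinarith

theorem theG_deg (m q : ℕ) (hm : 3 < m) [DecidableRel (theG m q).Adj] :
    (theG m q).maxDegree ≤ m := by
  apply SimpleGraph.maxDegree_le_of_forall_degree_le
  intro v
  rw [← SimpleGraph.card_neighborFinset_eq_degree]
  by_cases hv : v.val < 2
  · calc _ ≤ (univ.image (midV m q)).card := by
          apply Finset.card_le_card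
          intro w hw
          rw [SimpleGraph.mem_neighborFinset, theG_adj, mem_edgesS] at hw
          simp [Fin.ext_iff, midV_val, spV_val] at hw ⊢
          rcases hw with h | ⟨j, h⟩ | ⟨j, h⟩
          · omega
          · exact ⟨j, by omega⟩
          · exact ⟨j, by omega⟩
      _ ≤ _ := Finset.card_image_le.trans (by simp)
  · calc _ ≤ (univ.image (spV m q)).card := by
          apply Finset.card_le_card
          intro w hw
          rw [SimpleGraph.mem_neighborFinset, theG_adj, mem_edgesS] at hw
          simp [Fin.ext_iff, midV_val, spV_val] at hw ⊢
          have : w.val < 4 := by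
            rcases hw with h | ⟨j, h⟩ | ⟨j, h⟩ <;> omega
          exact ⟨⟨w.val, this⟩, rfl⟩
      _ ≤ 4 := Finset.card_image_le.trans (by simp)
      _ ≤ m := hm

theorem success_imp (m q n : ℕ) (xs : Fin n → Fin (4 + (m+q)) → Bool) (τ : ℝ)
    (h : thrGraph xs τ = theG m q) :
    0 < ∑ ℓ, (spin (xs ℓ (spV m q 2)) * spin (xs ℓ (spV m q 3))
        - spin (xs ℓ (spV m q 0)) * spin (xs ℓ (spV m q 1))) := by
  have h23 : (thrGraph xs τ).Adj (spV m q 2) (spV m q 3) := by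
    rw [h, theG_adj, mem_edgesS]; left; rfl
  have h01 : ¬ (thrGraph xs τ).Adj (spV m q 0) (spV m q 1) := by
    rw [h, theG_adj, mem_edgesS]
    simp [Fin.ext_iff, midV_val, spV_val]
    intros; omega
  have hs : ∀ i j, empCorr xs i j = empCorr xs j i := by
    intro i j; simp only [empCorr, mul_comm]
  have hne : spV m q 0 ≠ spV m q 1 := by simp [Fin.ext_iff, spV_val]
  simp only [thrGraph, SimpleGraph.fromRel_adj] at h23 h01
  have a : τ ≤ empCorr xs (spV m q 2) (spV m q 3) := by
    rcases h23.2 with h | h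
    · exact h
    · rwa [hs]
  have b : empCorr xs (spV m q 0) (spV m q 1) < τ := by
    by_contra hh
    push Not at hh
    exact h01 ⟨hne, Or.inl hh⟩
  have c := lt_of_lt_of_le b a
  rw [Finset.sum_sub_distrib, sub_pos]
  unfold empCorr at c
  rcases Nat.eq_zero_or_pos n with hn | hn
  · subst hn; simp at c
  · exact (div_lt_div_iff_of_pos_right (by exact_mod_cast hn)).1 c

/-- Theorem 2 of the paper. There is a numerical constant `K` such that for
every `Δ > 3` and `θ > K/Δ` there are graphs of maximum degree bounded by `Δ` (on arbitrarily
many vertices) on which the thresholding algorithm fails, for every threshold `τ` and every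
sample size `n`, with probability bounded away from zero. -/
theorem thresholding_failure :
    ∃ K : ℝ, 0 < K ∧ ∀ Δ : ℕ, 3 < Δ → ∀ θ : ℝ, K / Δ < θ →
      ∀ p₀ : ℕ, ∃ p : ℕ, p₀ ≤ p ∧
        ∃ G : SimpleGraph (Fin p), ∃ _ : DecidableRel G.Adj,
          G.maxDegree ≤ Δ ∧ ∃ δ₀ : ℝ, 0 < δ₀ ∧
            ∀ (τ : ℝ) (n : ℕ),
              sampleProb G θ n {xs | thrGraph xs τ = G} ≤ 1 - δ₀ := by
  refine ⟨2, by norm_num, fun Δ hΔ θ hθ p₀ => ⟨4 + (Δ + p₀), by omega, theG Δ p₀,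
    Classical.decRel _, ?_, ?_⟩⟩
  · exact @theG_deg Δ p₀ hΔ (Classical.decRel _)
  obtain ⟨t, ht, hE⟩ := theG_exp Δ p₀ hΔ θ hθ
  set E := ∑ x, isingProb (theG Δ p₀) θ x *
      rexp (t * (spin (x (spV Δ p₀ 2)) * spin (x (spV Δ p₀ 3))
        - spin (x (spV Δ p₀ 0)) * spin (x (spV Δ p₀ 1)))) with hEdef
  have hE0 : 0 ≤ E := Finset.sum_nonneg fun x _ =>
    mul_nonneg (prob_nonneg _ _ _) (Real.exp_pos _).le
  refine ⟨1 - E, by linarith, fun τ n => ?_⟩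
  rw [sub_sub_cancel]
  unfold sampleProb
  rcases Nat.eq_zero_or_pos n with hn | hn
  · subst hn
    refine le_trans (le_of_eq ?_) hE0
    refine Finset.sum_eq_zero fun xs _ => ?_
    rw [Set.indicator_of_notMem, zero_mul]
    intro h
    have := success_imp Δ p₀ 0 xs τ h
    simp at this
  · have hpow : E ^ n ≤ E := by
      calc E ^ n ≤ E ^ 1 := pow_le_pow_of_le_one hE0 hE.le hn
        _ = E := pow_one E
    refine le_trans ?_ hpow
    have hprod : E ^ n = ∑ xs : Fin n → Fin (4 + (Δ + p₀)) → Bool, ∏ ℓ,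
        (isingProb (theG Δ p₀) θ (xs ℓ) *
        rexp (t * (spin (xs ℓ (spV Δ p₀ 2)) * spin (xs ℓ (spV Δ p₀ 3))
        - spin (xs ℓ (spV Δ p₀ 0)) * spin (xs ℓ (spV Δ p₀ 1))))) := by
      have := Fintype.prod_sum (fun (_ : Fin n) (x : Fin (4 + (Δ + p₀)) → Bool) =>
        isingProb (theG Δ p₀) θ x *
        rexp (t * (spin (x (spV Δ p₀ 2)) * spin (x (spV Δ p₀ 3))
        - spin (x (spV Δ p₀ 0)) * spin (x (spV Δ p₀ 1)))))
      rw [← this, Finset.prod_const, Finset.card_univ, Fintype.card_fin]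
    rw [hprod]
    refine Finset.sum_le_sum fun xs _ => ?_
    rw [Finset.prod_mul_distrib, ← Real.exp_sum, ← Finset.mul_sum, mul_comm]
    refine mul_le_mul_of_nonneg_left ?_ (Finset.prod_nonneg fun ℓ _ => prob_nonneg _ _ _)
    by_cases h : thrGraph xs τ = theG Δ p₀
    · rw [Set.indicator_of_mem (by exact h)]
      exact Real.one_le_exp (mul_pos ht (success_imp Δ p₀ n xs τ h)).le
    · rw [Set.indicator_of_notMem (by exact h)]
      exact (Real.exp_pos _).le

end
end

section
/- There exist numerical constants K₁, K₂, K₃ such that the following holds. Let G be a finite simple graph on p vertices with maximum degree at most Δ, where Δ ≥ 3, and assume 0 < θ ≤ K₁/Δ. Set λ = K₃ θ Δ^{−1/2}. Then for any δ ∈ (0,1), if the number of i.i.d. samples from μ_{G,θ} satisfies n ≥ K₂ θ^{−2} Δ log(8p²/δ), the regularized logistic regression algorithm Rlr(λ) reconstructs the graph G exactly with probability at least 1 − δ. -/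
open Finset Real Filter

noncomputable section

/-- The conditional law `P_θ(x_r | x_{∖r})` of the pairwise model with parameter vector
`θv` (only the coordinates `θv j`, `j ≠ r`, matter). -/
def condLik {p : ℕ} (r : Fin p) (θv : Fin p → ℝ) (x : Fin p → Bool) : ℝ :=
  Real.exp (spin (x r) * ∑ j ∈ Finset.univ.erase r, θv j * spin (x j)) /
    (2 * Real.cosh (∑ j ∈ Finset.univ.erase r, θv j * spin (x j)))

/-- The pseudo-likelihood `L(θ_{r,·}; {x^{(ℓ)}})` at vertex `r`. -/
def pseudoLik {p n : ℕ} (r : Fin p) (θv : Fin p → ℝ)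
    (xs : Fin n → Fin p → Bool) : ℝ :=
  -(1 / n) * ∑ ℓ, Real.log (condLik r θv (xs ℓ))

/-- The `ℓ₁`-regularized pseudo-likelihood objective of `Rlr(λ)` at vertex `r`. -/
def rlrObj {p n : ℕ} (lam : ℝ) (r : Fin p) (θv : Fin p → ℝ)
    (xs : Fin n → Fin p → Bool) : ℝ :=
  pseudoLik r θv xs + lam * ∑ j ∈ Finset.univ.erase r, |θv j|

/-- `θv` is a global minimizer of the regularized objective at vertex `r`. -/
def IsRlrMin {p n : ℕ} (lam : ℝ) (r : Fin p) (xs : Fin n → Fin p → Bool)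
    (θv : Fin p → ℝ) : Prop :=
  ∀ θv' : Fin p → ℝ, rlrObj lam r θv xs ≤ rlrObj lam r θv' xs

/-- `Rlr(λ)` correctly reconstructs the neighbourhood of `r`: some minimizer `θ̂_{r,·}` of the
regularized objective declares `(r,j)` an edge (`θ̂_{rj} > 0`) exactly for `j ∈ ∂r`. -/
def rlrNbhdSuccess {p n : ℕ} (lam : ℝ) (r : Fin p) (xs : Fin n → Fin p → Bool)
    (G : SimpleGraph (Fin p)) : Prop :=
  ∃ θv : Fin p → ℝ, IsRlrMin lam r xs θv ∧ ∀ j : Fin p, j ≠ r → (0 < θv j ↔ G.Adj r j)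

/-- `Rlr(λ)` reconstructs the whole graph `G` (with some tie-breaking among minimizers). -/
def rlrSuccess {p n : ℕ} (lam : ℝ) (xs : Fin n → Fin p → Bool)
    (G : SimpleGraph (Fin p)) : Prop :=
  ∀ r : Fin p, rlrNbhdSuccess lam r xs G

/-- `Rlr(λ)` reconstructs the whole graph `G`, whatever the tie-breaking: at each vertex a
minimizer exists and every minimizer declares exactly the correct edges. -/
def rlrSuccessStrong {p n : ℕ} (lam : ℝ) (xs : Fin n → Fin p → Bool)
    (G : SimpleGraph (Fin p)) : Prop :=
  ∀ r : Fin p, (∃ θv, IsRlrMin lam r xs θv) ∧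
    ∀ θv : Fin p → ℝ, IsRlrMin lam r xs θv → ∀ j : Fin p, j ≠ r → (0 < θv j ↔ G.Adj r j)
namespace RlrAux

lemma hasDerivAt_tanh' (x : ℝ) : HasDerivAt Real.tanh (1 - Real.tanh x ^ 2) x := by
  have h : Real.tanh = fun y => Real.sinh y / Real.cosh y := by
    funext y; exact Real.tanh_eq_sinh_div_cosh y
  have hc := (Real.cosh_pos x).ne'
  have h2 := (Real.hasDerivAt_sinh x).div (Real.hasDerivAt_cosh x) hc
  have h3 : (Real.cosh x * Real.cosh x - Real.sinh x * Real.sinh x) / Real.cosh x ^ 2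
      = 1 - Real.tanh x ^ 2 := by
    rw [Real.tanh_eq_sinh_div_cosh]
    field_simp
  rw [← h3]
  rw [h]
  exact h2

lemma abs_tanh_le' (x : ℝ) : |Real.tanh x| ≤ |x| := by
  have h := Convex.norm_image_sub_le_of_norm_hasDerivWithin_le (f := Real.tanh)
    (f' := fun y => 1 - Real.tanh y ^ 2) (s := Set.univ) (C := 1) (x := 0) (y := x)
    (fun y _ => (hasDerivAt_tanh' y).hasDerivWithinAt)
    (fun y _ => by
      rw [Real.norm_eq_abs, abs_le]
      have := Real.tanh_sq_lt_one y
      constructor <;> nlinarith [sq_nonneg (Real.tanh y)])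
    convex_univ trivial trivial
  simpa using h

lemma tanh_diff (a b : ℝ) :
    |Real.tanh b - Real.tanh a - (b - a)| ≤ |b - a| * (a ^ 2 + b ^ 2) := by
  have h := Convex.norm_image_sub_le_of_norm_hasDerivWithin_le
    (f := fun y => Real.tanh y - y)
    (f' := fun y => (1 - Real.tanh y ^ 2) - 1) (s := Set.uIcc a b) (C := a ^ 2 + b ^ 2)
    (x := a) (y := b)
    (fun y _ => ((hasDerivAt_tanh' y).sub (hasDerivAt_id y)).hasDerivWithinAt)
    (fun y hy => by
      have h1 : Real.tanh y ^ 2 ≤ y ^ 2 := sq_le_sq.2 (abs_tanh_le' y)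
      have h2 : y ^ 2 ≤ a ^ 2 + b ^ 2 := by
        rcases Set.mem_uIcc.1 hy with ⟨h3, h4⟩ | ⟨h3, h4⟩
        · rcases le_total 0 y with h | h <;> nlinarith [sq_nonneg a, sq_nonneg b]
        · rcases le_total 0 y with h | h <;> nlinarith [sq_nonneg a, sq_nonneg b]
      rw [Real.norm_eq_abs, abs_le]
      constructor <;> nlinarith [sq_nonneg (Real.tanh y)])
    (convex_uIcc a b) Set.left_mem_uIcc Set.right_mem_uIcc
  simp only [Real.norm_eq_abs] at h
  calc _ = |Real.tanh b - b - (Real.tanh a - a)| := by congr 1; ring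
    _ ≤ _ := h
    _ = _ := by ring

def ph (h : ℝ) : ℝ := Real.log (2 * Real.cosh h)

lemma hasDerivAt_ph (x : ℝ) : HasDerivAt ph (Real.tanh x) x := by
  have hc := Real.cosh_pos x
  have := ((Real.hasDerivAt_cosh x).const_mul 2).log (by positivity)
  unfold ph
  convert this using 1
  rw [Real.tanh_eq_sinh_div_cosh]
  field_simp

lemma cosh_ratio (a b : ℝ) : Real.cosh b = Real.cosh a *
    ((1 + Real.tanh a) / 2 * Real.exp (b - a) + (1 - Real.tanh a) / 2 * Real.exp (-(b - a))) := by
  have hc := (Real.cosh_pos a).ne'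
  have e : b = a + (b - a) := by ring
  generalize b - a = d at e
  subst e
  rw [Real.cosh_add, Real.tanh_eq_sinh_div_cosh, Real.sinh_eq d, Real.cosh_eq d]
  field_simp
  ring

lemma ph_tangent (a b : ℝ) : 0 ≤ ph b - ph a - Real.tanh a * (b - a) := by
  have hca := Real.cosh_pos a
  have hcb := Real.cosh_pos b
  have h1 := Real.tanh_lt_one a
  have h2 := Real.neg_one_lt_tanh a
  have hJ := convexOn_exp.2 (Set.mem_univ (b - a)) (Set.mem_univ (-(b - a)))
    (show (0 : ℝ) ≤ (1 + Real.tanh a) / 2 by linarith)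
    (show (0 : ℝ) ≤ (1 - Real.tanh a) / 2 by linarith) (by ring)
  simp only [smul_eq_mul] at hJ
  have h3 : Real.exp (Real.tanh a * (b - a)) * Real.cosh a ≤ Real.cosh b := by
    rw [cosh_ratio a b, mul_comm]
    apply mul_le_mul_of_nonneg_left _ hca.le
    convert hJ using 2
    ring
  have h4 : Real.log (Real.exp (Real.tanh a * (b - a)) * Real.cosh a) ≤ Real.log (Real.cosh b) :=
    Real.log_le_log (by positivity) h3
  rw [Real.log_mul (Real.exp_ne_zero _) hca.ne', Real.log_exp] at h4
  unfold ph
  rw [Real.log_mul two_ne_zero hca.ne', Real.log_mul two_ne_zero hcb.ne']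
  linarith

lemma ph_tangent_strict (a b : ℝ) (hab : a ≠ b) : 0 < ph b - ph a - Real.tanh a * (b - a) := by
  have hca := Real.cosh_pos a
  have hcb := Real.cosh_pos b
  have h1 := Real.tanh_lt_one a
  have h2 := Real.neg_one_lt_tanh a
  have hJ := strictConvexOn_exp.2 (Set.mem_univ (b - a)) (Set.mem_univ (-(b - a)))
    (fun h => hab (by linarith))
    (show (0 : ℝ) < (1 + Real.tanh a) / 2 by linarith)
    (show (0 : ℝ) < (1 - Real.tanh a) / 2 by linarith) (by ring)
  simp only [smul_eq_mul] at hJ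
  have h3 : Real.exp (Real.tanh a * (b - a)) * Real.cosh a < Real.cosh b := by
    rw [cosh_ratio a b, mul_comm]
    apply mul_lt_mul_of_pos_left _ hca
    convert hJ using 2
    ring
  have h4 : Real.log (Real.exp (Real.tanh a * (b - a)) * Real.cosh a) < Real.log (Real.cosh b) :=
    Real.log_lt_log (by positivity) h3
  rw [Real.log_mul (Real.exp_ne_zero _) hca.ne', Real.log_exp] at h4
  unfold ph
  rw [Real.log_mul two_ne_zero hca.ne', Real.log_mul two_ne_zero hcb.ne']
  linarith

lemma spin_sq (b : Bool) : spin b * spin b = 1 := by cases b <;> norm_num [spin]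
lemma abs_spin (b : Bool) : |spin b| = 1 := by cases b <;> norm_num [spin]

def av {n : ℕ} (f : Fin n → ℝ) : ℝ := (∑ l, f l) / n

lemma av_add {n : ℕ} (f g : Fin n → ℝ) : av (fun l => f l + g l) = av f + av g := by
  simp [av, Finset.sum_add_distrib, add_div]
lemma av_sub {n : ℕ} (f g : Fin n → ℝ) : av (fun l => f l - g l) = av f - av g := by
  simp [av, Finset.sum_sub_distrib, sub_div]
lemma av_mul {n : ℕ} (c : ℝ) (f : Fin n → ℝ) : av (fun l => c * f l) = c * av f := by
  simp [av, ← Finset.mul_sum, mul_div_assoc]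
lemma av_sum {n : ℕ} {ι : Type*} (s : Finset ι) (f : ι → Fin n → ℝ) :
    av (fun l => ∑ i ∈ s, f i l) = ∑ i ∈ s, av (f i) := by
  simp only [av]; rw [Finset.sum_comm, Finset.sum_div]
lemma av_mono {n : ℕ} {f g : Fin n → ℝ} (h : ∀ l, f l ≤ g l) : av f ≤ av g := by
  unfold av
  gcongr with l
  exact h l
lemma abs_av_le {n : ℕ} (f : Fin n → ℝ) : |av f| ≤ av (fun l => |f l|) := by
  unfold av
  rw [abs_div, Nat.abs_cast]
  gcongr
  exact Finset.abs_sum_le_sum_abs _ _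
lemma abs_av_le_of {n : ℕ} {f g : Fin n → ℝ} (h : ∀ l, |f l| ≤ g l) : |av f| ≤ av g :=
  (abs_av_le f).trans (av_mono h)
lemma av_one {n : ℕ} (hn : 0 < n) : av (fun _ : Fin n => (1 : ℝ)) = 1 := by
  have : (n : ℝ) ≠ 0 := by positivity
  simp [av, this]

def lin {p : ℕ} (r : Fin p) (v : Fin p → ℝ) (x : Fin p → Bool) : ℝ :=
  ∑ j ∈ Finset.univ.erase r, v j * spin (x j)

def grad {p n : ℕ} (r : Fin p) (v : Fin p → ℝ) (xs : Fin n → Fin p → Bool) (j : Fin p) : ℝ :=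
  av (fun l => spin (xs l j) * (Real.tanh (lin r v (xs l)) - spin (xs l r)))

lemma pseudoLik_eq {p n : ℕ} (r : Fin p) (v : Fin p → ℝ) (xs : Fin n → Fin p → Bool) :
    pseudoLik r v xs = av (fun l => ph (lin r v (xs l)) - spin (xs l r) * lin r v (xs l)) := by
  unfold pseudoLik av
  rw [neg_mul, ← mul_neg, ← Finset.sum_neg_distrib, one_div, inv_mul_eq_div]
  congr 1
  apply Finset.sum_congr rfl
  intro l _
  unfold condLik ph lin
  have := Real.cosh_pos (∑ j ∈ Finset.univ.erase r, v j * spin (xs l j))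
  rw [Real.log_div (Real.exp_ne_zero _) (by positivity), Real.log_exp]
  ring

/-- Bregman divergence -/
lemma pseudoLik_breg {p n : ℕ} (r : Fin p) (w v : Fin p → ℝ) (xs : Fin n → Fin p → Bool) :
    pseudoLik r v xs - pseudoLik r w xs - ∑ j ∈ Finset.univ.erase r, grad r w xs j * (v j - w j)
      = av (fun l => ph (lin r v (xs l)) - ph (lin r w (xs l))
          - Real.tanh (lin r w (xs l)) * (lin r v (xs l) - lin r w (xs l))) := by
  have h : ∑ j ∈ Finset.univ.erase r, grad r w xs j * (v j - w j)
      = av (fun l => (Real.tanh (lin r w (xs l)) - spin (xs l r)) *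
          (lin r v (xs l) - lin r w (xs l))) := by
    have : ∀ l, (Real.tanh (lin r w (xs l)) - spin (xs l r)) *
          (lin r v (xs l) - lin r w (xs l)) = ∑ j ∈ Finset.univ.erase r,
            (v j - w j) * (spin (xs l j) * (Real.tanh (lin r w (xs l)) - spin (xs l r))) := by
      intro l
      conv_lhs => enter [2]; unfold lin
      rw [← Finset.sum_sub_distrib, Finset.mul_sum]
      apply Finset.sum_congr rfl
      intro j _
      ring
    simp only [this]
    rw [av_sum]
    apply Finset.sum_congr rfl
    intro j _
    rw [av_mul, grad, mul_comm]
  rw [h, pseudoLik_eq, pseudoLik_eq, ← av_sub, ← av_sub]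
  congr 1
  funext l
  ring

lemma pseudoLik_tangent {p n : ℕ} (r : Fin p) (w v : Fin p → ℝ) (xs : Fin n → Fin p → Bool) :
    ∑ j ∈ Finset.univ.erase r, grad r w xs j * (v j - w j) ≤
      pseudoLik r v xs - pseudoLik r w xs := by
  have h := pseudoLik_breg r w v xs
  have : 0 ≤ av (fun l => ph (lin r v (xs l)) - ph (lin r w (xs l))
          - Real.tanh (lin r w (xs l)) * (lin r v (xs l) - lin r w (xs l))) := by
    unfold av
    apply div_nonneg _ (Nat.cast_nonneg _)
    exact Finset.sum_nonneg fun l _ => ph_tangent _ _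
  linarith

lemma pseudoLik_tangent_eq {p n : ℕ} (hn : 0 < n) (r : Fin p) (w v : Fin p → ℝ)
    (xs : Fin n → Fin p → Bool)
    (he : pseudoLik r v xs - pseudoLik r w xs ≤
      ∑ j ∈ Finset.univ.erase r, grad r w xs j * (v j - w j)) (l : Fin n) :
    lin r v (xs l) = lin r w (xs l) := by
  have h := pseudoLik_breg r w v xs
  by_contra hne
  have : 0 < av (fun l => ph (lin r v (xs l)) - ph (lin r w (xs l))
          - Real.tanh (lin r w (xs l)) * (lin r v (xs l) - lin r w (xs l))) := by
    unfold av
    apply div_pos _ (by positivity)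
    exact Finset.sum_pos' (fun l _ => ph_tangent _ _)
      ⟨l, Finset.mem_univ _, ph_tangent_strict _ _ (Ne.symm hne)⟩
  linarith

lemma lin_update {p : ℕ} (r : Fin p) (v : Fin p → ℝ) (x : Fin p → Bool) (k : Fin p) (hk : k ≠ r)
    (t : ℝ) : lin r (Function.update v k (v k + t)) x = lin r v x + t * spin (x k) := by
  have hk' : k ∈ Finset.univ.erase r := by simp [hk]
  unfold lin
  rw [← Finset.add_sum_erase _ _ hk', ← Finset.add_sum_erase _ _ hk']
  have : ∑ j ∈ (Finset.univ.erase r).erase k, Function.update v k (v k + t) j * spin (x j)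
      = ∑ j ∈ (Finset.univ.erase r).erase k, v j * spin (x j) := by
    apply Finset.sum_congr rfl
    intro j hj
    rw [Function.update_of_ne (Finset.ne_of_mem_erase hj)]
  rw [this, Function.update_self]
  ring

lemma abs_update {p : ℕ} (r : Fin p) (v : Fin p → ℝ) (k : Fin p) (hk : k ≠ r)
    (t : ℝ) : ∑ j ∈ Finset.univ.erase r, |Function.update v k (v k + t) j| =
      ∑ j ∈ Finset.univ.erase r, |v j| + (|v k + t| - |v k|) := by
  have hk' : k ∈ Finset.univ.erase r := by simp [hk]
  rw [← Finset.add_sum_erase _ _ hk', ← Finset.add_sum_erase _ _ hk']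
  have : ∑ j ∈ (Finset.univ.erase r).erase k, |Function.update v k (v k + t) j|
      = ∑ j ∈ (Finset.univ.erase r).erase k, |v j| := by
    apply Finset.sum_congr rfl
    intro j hj
    rw [Function.update_of_ne (Finset.ne_of_mem_erase hj)]
  rw [this, Function.update_self]
  ring

lemma pseudoLik_hasDeriv {p n : ℕ} (r : Fin p) (v : Fin p → ℝ) (xs : Fin n → Fin p → Bool)
    (k : Fin p) (hk : k ≠ r) :
    HasDerivAt (fun t => pseudoLik r (Function.update v k (v k + t)) xs) (grad r v xs k) 0 := by
  simp only [pseudoLik_eq, lin_update r v _ k hk]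
  unfold grad av
  apply HasDerivAt.div_const
  apply HasDerivAt.fun_sum
  intro l _
  have h1 : HasDerivAt (fun t : ℝ => lin r v (xs l) + t * spin (xs l k)) (spin (xs l k)) 0 := by
    simpa using ((hasDerivAt_id (0 : ℝ)).mul_const (spin (xs l k))).const_add (lin r v (xs l))
  have h2 : HasDerivAt ph (Real.tanh (lin r v (xs l)))
      ((fun t : ℝ => lin r v (xs l) + t * spin (xs l k)) 0) := by
    simpa using hasDerivAt_ph (lin r v (xs l))
  have h3 := (h2.comp (0 : ℝ) h1).sub (h1.const_mul (spin (xs l r)))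
  refine HasDerivAt.congr_deriv h3 ?_
  ring

lemma rlrObj_continuous {p n : ℕ} (lam : ℝ) (r : Fin p) (xs : Fin n → Fin p → Bool) :
    Continuous (fun v : Fin p → ℝ => rlrObj lam r v xs) := by
  unfold rlrObj
  simp only [pseudoLik_eq]
  have hp : Continuous ph := continuous_iff_continuousAt.2 fun x => (hasDerivAt_ph x).continuousAt
  have hl : ∀ x, Continuous (fun v : Fin p → ℝ => lin r v x) := by
    intro x; unfold lin; fun_prop
  unfold av
  have := fun l => hp.comp (hl (xs l))
  simp only [Function.comp_def] at this
  have h2 := fun l => hl (xs l)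
  fun_prop

lemma empCorr_av {p n : ℕ} (xs : Fin n → Fin p → Bool) (i j : Fin p) :
    empCorr xs i j = av (fun l => spin (xs l i) * spin (xs l j)) := rfl

lemma empCorr_self {p n : ℕ} (hn : 0 < n) (xs : Fin n → Fin p → Bool) (i : Fin p) :
    empCorr xs i i = 1 := by
  rw [empCorr_av]; simp only [spin_sq]; exact av_one hn

lemma empCorr_comm {p n : ℕ} (xs : Fin n → Fin p → Bool) (i j : Fin p) :
    empCorr xs i j = empCorr xs j i := by
  simp only [empCorr, mul_comm]

lemma rowsum {p n : ℕ} (hn : 0 < n) (xs : Fin n → Fin p → Bool) (i : Fin p) (S : Finset (Fin p))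
    (M : ℝ) (h : ∑ k ∈ S.erase i, |empCorr xs i k| ≤ M) :
    ∑ k ∈ S, |empCorr xs i k| ≤ 1 + M := by
  by_cases hi : i ∈ S
  · rw [← Finset.add_sum_erase _ _ hi, empCorr_self hn, abs_one]
    linarith
  · rw [Finset.erase_eq_of_notMem hi] at h
    linarith

lemma quad {p n : ℕ} (hn : 0 < n) (xs : Fin n → Fin p → Bool) (Δ : ℕ) (M : ℝ) (hM0 : 0 ≤ M)
    (hM : ∀ (j : Fin p) (S : Finset (Fin p)), S.card ≤ Δ →
      ∑ k ∈ S.erase j, |empCorr xs j k| ≤ M)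
    (N : Finset (Fin p)) (hN : N.card ≤ Δ) (w : Fin p → ℝ) (c : ℝ)
    (hw : ∀ k ∈ N, |w k| ≤ c) (hc : 0 ≤ c) :
    av (fun l => (∑ k ∈ N, w k * spin (xs l k)) ^ 2) ≤ c ^ 2 * (Δ * (1 + M)) := by
  have h1 : ∀ l, (∑ k ∈ N, w k * spin (xs l k)) ^ 2 =
      ∑ i ∈ N, ∑ k ∈ N, (w i * w k) * (spin (xs l i) * spin (xs l k)) := by
    intro l
    rw [sq, Finset.sum_mul_sum]
    apply Finset.sum_congr rfl; intro i _
    apply Finset.sum_congr rfl; intro k _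
    ring
  simp only [h1]
  rw [av_sum]
  calc _ = ∑ i ∈ N, ∑ k ∈ N, (w i * w k) * empCorr xs i k := by
        apply Finset.sum_congr rfl; intro i _
        rw [av_sum]
        apply Finset.sum_congr rfl; intro k _
        rw [av_mul, empCorr_av]
    _ ≤ ∑ i ∈ N, ∑ k ∈ N, c ^ 2 * |empCorr xs i k| := by
        apply Finset.sum_le_sum; intro i hi
        apply Finset.sum_le_sum; intro k hk
        refine (le_abs_self _).trans ?_
        rw [abs_mul, abs_mul, sq]
        gcongr
        · exact hw i hi
        · exact hw k hk
    _ ≤ ∑ i ∈ N, c ^ 2 * (1 + M) := by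
        apply Finset.sum_le_sum; intro i hi
        rw [← Finset.mul_sum]
        gcongr
        exact rowsum hn xs i N M (hM i N hN)
    _ = N.card * (c ^ 2 * (1 + M)) := by simp
    _ ≤ Δ * (c ^ 2 * (1 + M)) := by
        gcongr
    _ = _ := by ring

lemma abs_lin_le {p : ℕ} (Δ : ℕ) (N : Finset (Fin p)) (hN : N.card ≤ Δ) (w : Fin p → ℝ) (c : ℝ)
    (hw : ∀ k ∈ N, |w k| ≤ c) (hc : 0 ≤ c) (x : Fin p → Bool) :
    |∑ k ∈ N, w k * spin (x k)| ≤ c * Δ := by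
  calc _ ≤ ∑ k ∈ N, |w k * spin (x k)| := Finset.abs_sum_le_sum_abs _ _
    _ ≤ ∑ k ∈ N, c := by
        apply Finset.sum_le_sum; intro k hk
        rw [abs_mul, abs_spin, mul_one]; exact hw k hk
    _ = N.card * c := by simp
    _ ≤ Δ * c := by gcongr
    _ = _ := by ring

/-- the residual correlations -/
def res {p n : ℕ} (G : SimpleGraph (Fin p)) [DecidableRel G.Adj] (θ : ℝ)
    (xs : Fin n → Fin p → Bool) (j k : Fin p) : ℝ :=
  av (fun l => spin (xs l k) *
    (spin (xs l j) - Real.tanh (∑ i ∈ G.neighborFinset j, θ * spin (xs l i))))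

lemma corr_small {p n : ℕ} (hn : 0 < n) (G : SimpleGraph (Fin p)) [DecidableRel G.Adj] (Δ : ℕ)
    (hΔ : ∀ v, G.degree v ≤ Δ) (θ η : ℝ) (hθ : 0 < θ) (hK : θ * Δ ≤ 1 / 100)
    (hη : Δ * η ≤ 1 / 100) (hη0 : 0 ≤ η) (xs : Fin n → Fin p → Bool)
    (hW : ∀ j k, k ≠ j → |res G θ xs j k| ≤ η) :
    ∀ (j : Fin p) (S : Finset (Fin p)), S.card ≤ Δ →
      ∑ k ∈ S.erase j, |empCorr xs j k| ≤ 1 / 20 := by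
  intro j1 S1 hS1
  obtain ⟨⟨j, S⟩, hS, hmax⟩ := Finset.exists_max_image
    ((Finset.univ : Finset (Fin p × Finset (Fin p))).filter (fun a => a.2.card ≤ Δ))
    (fun a => ∑ k ∈ a.2.erase a.1, |empCorr xs a.1 k|) ⟨(j1, S1), by simp [hS1]⟩
  simp only [Finset.mem_filter, Finset.mem_univ, true_and] at hS hmax
  set M := ∑ k ∈ S.erase j, |empCorr xs j k| with hMdef
  have hM : ∀ (j : Fin p) (S : Finset (Fin p)), S.card ≤ Δ →
      ∑ k ∈ S.erase j, |empCorr xs j k| ≤ M := fun j S h => hmax (j, S) h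
  have hM0 : 0 ≤ M := Finset.sum_nonneg fun _ _ => abs_nonneg _
  refine (hM j1 S1 hS1).trans ?_
  set N := G.neighborFinset j with hN
  have hNc : N.card ≤ Δ := by rw [hN, G.card_neighborFinset_eq_degree]; exact hΔ j
  have hq := quad hn xs Δ M hM0 hM N hNc (fun _ => θ) θ (fun _ _ => by rw [abs_of_pos hθ]) hθ.le
  have hb := fun l => abs_lin_le Δ N hNc (fun _ => θ) θ (fun _ _ => by rw [abs_of_pos hθ])
    hθ.le (xs l)
  -- pointwise bound
  have key : ∀ k ∈ S.erase j, |empCorr xs j k| ≤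
      θ * ∑ i ∈ N, |empCorr xs i k| + (θ * Δ) * (θ ^ 2 * (Δ * (1 + M))) + η := by
    intro k hk
    have hkj : k ≠ j := Finset.ne_of_mem_erase hk
    have e : empCorr xs j k = θ * ∑ i ∈ N, empCorr xs i k
        + av (fun l => spin (xs l k) * (Real.tanh (∑ i ∈ N, θ * spin (xs l i))
          - ∑ i ∈ N, θ * spin (xs l i))) + res G θ xs j k := by
      have : θ * ∑ i ∈ N, empCorr xs i k = av (fun l => spin (xs l k) *
          ∑ i ∈ N, θ * spin (xs l i)) := by
        simp only [Finset.mul_sum]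
        rw [av_sum]
        apply Finset.sum_congr rfl; intro i _
        rw [empCorr_av, ← av_mul]
        congr 1; funext l; ring
      rw [this, res, ← av_add, ← av_add, empCorr_av]
      congr 1; funext l; ring
    have hR : |av (fun l => spin (xs l k) * (Real.tanh (∑ i ∈ N, θ * spin (xs l i))
          - ∑ i ∈ N, θ * spin (xs l i)))| ≤ (θ * Δ) * (θ ^ 2 * (Δ * (1 + M))) := by
      refine (abs_av_le_of (g := fun l => (θ * Δ) * (∑ i ∈ N, θ * spin (xs l i)) ^ 2) ?_).trans ?_
      · intro l
        rw [abs_mul, abs_spin, one_mul]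
        have := tanh_diff 0 (∑ i ∈ N, θ * spin (xs l i))
        simp only [Real.tanh_zero, sub_zero] at this
        refine this.trans ?_
        have h2 := hb l
        rw [zero_pow two_ne_zero, zero_add]
        gcongr
      · rw [av_mul]
        gcongr
    have h1 : |θ * ∑ i ∈ N, empCorr xs i k| ≤ θ * ∑ i ∈ N, |empCorr xs i k| := by
      rw [abs_mul, abs_of_pos hθ]
      gcongr
      exact Finset.abs_sum_le_sum_abs _ _
    rw [e]
    refine (abs_add_le _ _).trans ?_
    refine add_le_add ((abs_add_le _ _).trans (add_le_add h1 hR)) (hW j k hkj)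
  have hSc : ((S.erase j).card : ℝ) ≤ Δ := by
    exact_mod_cast (Finset.card_le_card (Finset.erase_subset _ _)).trans hS
  have hsum : M ≤ θ * (Δ * (1 + M)) + Δ * ((θ * Δ) * (θ ^ 2 * (Δ * (1 + M))) + η) := by
    calc M ≤ ∑ k ∈ S.erase j, (θ * ∑ i ∈ N, |empCorr xs i k|
          + (θ * Δ) * (θ ^ 2 * (Δ * (1 + M))) + η) := Finset.sum_le_sum key
      _ = θ * ∑ i ∈ N, ∑ k ∈ S.erase j, |empCorr xs i k|
          + (S.erase j).card * ((θ * Δ) * (θ ^ 2 * (Δ * (1 + M))) + η) := by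
        simp only [add_assoc]
        rw [Finset.sum_add_distrib, ← Finset.mul_sum, Finset.sum_comm, Finset.sum_const,
          nsmul_eq_mul]
      _ ≤ θ * ∑ i ∈ N, (1 + M) + Δ * ((θ * Δ) * (θ ^ 2 * (Δ * (1 + M))) + η) := by
        gcongr with i hi
        exact rowsum hn xs i _ M (hM i _ (by exact_mod_cast hSc))
      _ ≤ _ := by
        rw [Finset.sum_const, nsmul_eq_mul]
        gcongr
  have ha : 0 ≤ θ * Δ := by positivity
  have h3 : (θ * Δ) ^ 3 ≤ (1 / 100) ^ 3 := pow_le_pow_left₀ ha hK 3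
  have h4 : M ≤ (θ * Δ) * (1 + M) + (θ * Δ) ^ 3 * (1 + M) + Δ * η := by
    calc M ≤ _ := hsum
      _ = _ := by ring
  nlinarith

lemma lin_supp {p : ℕ} (G : SimpleGraph (Fin p)) [DecidableRel G.Adj] (r : Fin p)
    (w : Fin p → ℝ) (hw : ∀ k, k ≠ r → ¬ G.Adj r k → w k = 0) (x : Fin p → Bool) :
    lin r w x = ∑ k ∈ G.neighborFinset r, w k * spin (x k) := by
  unfold lin
  symm
  apply Finset.sum_subset
  · intro k hk
    simp only [SimpleGraph.mem_neighborFinset] at hk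
    simp [hk.ne']
  · intro k hk hk2
    simp only [SimpleGraph.mem_neighborFinset] at hk2
    rw [hw k (Finset.ne_of_mem_erase hk) hk2, zero_mul]

lemma av_lin {p n : ℕ} (xs : Fin n → Fin p → Bool) (N : Finset (Fin p)) (u : Fin p → ℝ)
    (j : Fin p) : av (fun l => spin (xs l j) * ∑ k ∈ N, u k * spin (xs l k)) =
      ∑ k ∈ N, u k * empCorr xs j k := by
  simp only [Finset.mul_sum]
  rw [av_sum]
  apply Finset.sum_congr rfl; intro k _
  rw [empCorr_av, ← av_mul]
  congr 1; funext l; ring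

lemma offdiag {p n : ℕ} (hn : 0 < n) (xs : Fin n → Fin p → Bool) (Δ : ℕ)
    (hM : ∀ (j : Fin p) (S : Finset (Fin p)), S.card ≤ Δ →
      ∑ k ∈ S.erase j, |empCorr xs j k| ≤ 1 / 20)
    (N : Finset (Fin p)) (hN : N.card ≤ Δ) (u : Fin p → ℝ) (c : ℝ) (hc : 0 ≤ c)
    (hu : ∀ k ∈ N, |u k| ≤ c) (j : Fin p) :
    |∑ k ∈ N, u k * empCorr xs j k - (if j ∈ N then u j else 0)| ≤ c * (1 / 20) := by
  have e : ∑ k ∈ N, u k * empCorr xs j k - (if j ∈ N then u j else 0)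
      = ∑ k ∈ N.erase j, u k * empCorr xs j k := by
    split_ifs with h
    · rw [← Finset.add_sum_erase _ _ h, empCorr_self hn]; ring
    · rw [Finset.erase_eq_of_notMem h]; ring
  rw [e]
  calc _ ≤ ∑ k ∈ N.erase j, |u k * empCorr xs j k| := Finset.abs_sum_le_sum_abs _ _
    _ ≤ ∑ k ∈ N.erase j, c * |empCorr xs j k| := by
      apply Finset.sum_le_sum; intro k hk
      rw [abs_mul]
      have := hu k (Finset.mem_of_mem_erase hk)
      gcongr
    _ = c * ∑ k ∈ N.erase j, |empCorr xs j k| := by rw [Finset.mul_sum]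
    _ ≤ _ := by
      have := hM j N hN
      gcongr

lemma main_est {p n : ℕ} (hn : 0 < n) (G : SimpleGraph (Fin p)) [DecidableRel G.Adj] (Δ : ℕ)
    (hΔ : ∀ v, G.degree v ≤ Δ) (θ lam : ℝ) (hθ : 0 < θ) (hK : θ * Δ ≤ 1 / 100)
    (hl0 : 0 < lam) (hl : lam ≤ θ / 4) (xs : Fin n → Fin p → Bool)
    (hW : ∀ j k, k ≠ j → |res G θ xs j k| ≤ lam / 8)
    (hM : ∀ (j : Fin p) (S : Finset (Fin p)), S.card ≤ Δ →
      ∑ k ∈ S.erase j, |empCorr xs j k| ≤ 1 / 20)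
    (r : Fin p) (w : Fin p → ℝ) (hw : ∀ k, k ≠ r → ¬ G.Adj r k → w k = 0)
    (hw2 : ∀ k, G.Adj r k → |w k - θ| ≤ 2 * lam) (j : Fin p) (hj : j ≠ r) :
    |grad r w xs j - (if G.Adj r j then w j - θ else 0)| ≤ 3 / 8 * lam := by
  set N := G.neighborFinset r with hN
  have hmem : ∀ k, k ∈ N ↔ G.Adj r k := fun k => by rw [hN, SimpleGraph.mem_neighborFinset]
  have hNc : N.card ≤ Δ := by rw [hN, G.card_neighborFinset_eq_degree]; exact hΔ r
  have e : grad r w xs j = ∑ k ∈ N, (w k - θ) * empCorr xs j k +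
      av (fun l => spin (xs l j) * (Real.tanh (∑ k ∈ N, w k * spin (xs l k))
        - Real.tanh (∑ k ∈ N, θ * spin (xs l k))
        - (∑ k ∈ N, w k * spin (xs l k) - ∑ k ∈ N, θ * spin (xs l k)))) - res G θ xs r j := by
    have h1 := av_lin xs N (fun k => w k - θ) j
    rw [← h1, res, ← av_add, ← av_sub, grad]
    congr 1; funext l
    rw [lin_supp G r w hw, ← hN]
    simp only [sub_mul, Finset.sum_sub_distrib]
    ring
  have h1 := offdiag hn xs Δ hM N hNc (fun k => w k - θ) (2 * lam) (by linarith)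
    (fun k hk => hw2 k ((hmem k).1 hk)) j
  have hwb : ∀ k ∈ N, |w k| ≤ 2 * θ := by
    intro k hk
    have := hw2 k ((hmem k).1 hk)
    rw [abs_le] at this ⊢
    constructor <;> linarith
  have q1 := quad hn xs Δ (1 / 20) (by norm_num) hM N hNc (fun _ => θ) θ
    (fun _ _ => by rw [abs_of_pos hθ]) hθ.le
  have q2 := quad hn xs Δ (1 / 20) (by norm_num) hM N hNc w (2 * θ) hwb (by linarith)
  have h2 : |av (fun l => spin (xs l j) * (Real.tanh (∑ k ∈ N, w k * spin (xs l k))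
        - Real.tanh (∑ k ∈ N, θ * spin (xs l k))
        - (∑ k ∈ N, w k * spin (xs l k) - ∑ k ∈ N, θ * spin (xs l k))))| ≤
      (2 * lam * Δ) * (θ ^ 2 * (Δ * (1 + 1 / 20)) + (2 * θ) ^ 2 * (Δ * (1 + 1 / 20))) := by
    refine (abs_av_le_of (g := fun l => (2 * lam * Δ) * ((∑ k ∈ N, θ * spin (xs l k)) ^ 2
      + (∑ k ∈ N, w k * spin (xs l k)) ^ 2)) ?_).trans ?_
    · intro l
      rw [abs_mul, abs_spin, one_mul]
      refine (tanh_diff _ _).trans ?_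
      have h5 : |∑ k ∈ N, w k * spin (xs l k) - ∑ k ∈ N, θ * spin (xs l k)| ≤ 2 * lam * Δ := by
        have := abs_lin_le Δ N hNc (fun k => w k - θ) (2 * lam)
          (fun k hk => hw2 k ((hmem k).1 hk)) (by linarith) (xs l)
        simpa only [sub_mul, Finset.sum_sub_distrib] using this
      gcongr
    · rw [av_mul, av_add]
      gcongr
  have h3 := hW r j hj
  have hif : (if j ∈ N then (fun k => w k - θ) j else 0) = (if G.Adj r j then w j - θ else 0) := by
    simp only [hmem]
  rw [hif] at h1
  have ha : 0 ≤ θ * Δ := by positivity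
  have h4 : (θ * Δ) ^ 2 ≤ (1 / 100) ^ 2 := pow_le_pow_left₀ ha hK 2
  have h6 : (2 * lam * Δ) * (θ ^ 2 * (Δ * (1 + 1 / 20)) + (2 * θ) ^ 2 * (Δ * (1 + 1 / 20)))
      ≤ lam / 100 := by
    calc _ = lam * (10.5 * (θ * Δ) ^ 2) := by ring
      _ ≤ lam * (10.5 * (1 / 100) ^ 2) := by gcongr
      _ ≤ _ := by linarith
  have h2' := h2.trans h6
  rw [e]
  rw [abs_le] at h1 h2' h3 ⊢
  constructor <;> linarith [h1.1, h1.2, h2'.1, h2'.2, h3.1, h3.2]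

lemma rlrObj_def' {p n : ℕ} (lam : ℝ) (r : Fin p) (v : Fin p → ℝ) (xs : Fin n → Fin p → Bool) :
  rlrObj lam r v xs = pseudoLik r v xs + lam * ∑ j ∈ Finset.univ.erase r, |v j| := rfl

/-- the coordinate move -/
lemma move {p n : ℕ} (lam : ℝ) (r : Fin p) (w : Fin p → ℝ) (xs : Fin n → Fin p → Bool)
    (k : Fin p) (hk : k ≠ r) (t : ℝ) :
    rlrObj lam r (Function.update w k (w k + t)) xs - rlrObj lam r w xs ≤
      grad r (Function.update w k (w k + t)) xs k * t + lam * (|w k + t| - |w k|) := by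
  have h := pseudoLik_tangent r (Function.update w k (w k + t)) w xs
  have hk' : k ∈ Finset.univ.erase r := by simp [hk]
  rw [← Finset.add_sum_erase _ _ hk', Function.update_self] at h
  have h0 : ∑ j ∈ (Finset.univ.erase r).erase k,
      grad r (Function.update w k (w k + t)) xs j * (w j - Function.update w k (w k + t) j) = 0 := by
    apply Finset.sum_eq_zero
    intro j hj
    rw [Function.update_of_ne (Finset.ne_of_mem_erase hj)]; ring
  rw [h0] at h
  rw [rlrObj_def', rlrObj_def', abs_update r w k hk]
  linarith

lemma determ {p n : ℕ} (hn : 0 < n) (G : SimpleGraph (Fin p)) [DecidableRel G.Adj] (Δ : ℕ)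
    (hΔ : ∀ v, G.degree v ≤ Δ) (θ lam : ℝ) (hθ : 0 < θ) (hK : θ * Δ ≤ 1 / 100)
    (hl0 : 0 < lam) (hl : lam ≤ θ / 4) (xs : Fin n → Fin p → Bool)
    (hW : ∀ j k, k ≠ j → |res G θ xs j k| ≤ lam / 8) :
    rlrSuccessStrong lam xs G := by
  have hM := corr_small hn G Δ hΔ θ (lam / 8) hθ hK
    (by
      have : (Δ : ℝ) * (lam / 8) ≤ Δ * (θ / 4 / 8) := by gcongr
      nlinarith) (by linarith) xs hW
  intro r
  -- the box
  set B : Set (Fin p → ℝ) := Set.pi Set.univ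
    (fun k => if G.Adj r k then Set.Icc (θ - 2 * lam) (θ + 2 * lam) else {0}) with hB
  have hBmem : ∀ w, w ∈ B ↔ (∀ k, ¬ G.Adj r k → w k = 0) ∧ ∀ k, G.Adj r k → |w k - θ| ≤ 2 * lam := by
    intro w
    simp only [hB, Set.mem_pi, Set.mem_univ, true_implies]
    constructor
    · intro h
      refine ⟨fun k hk => ?_, fun k hk => ?_⟩
      · have := h k
        rw [if_neg hk] at this
        exact this
      · have := h k
        rw [if_pos hk] at this
        rw [abs_le]
        constructor <;> linarith [this.1, this.2]
    · intro h k
      split_ifs with hk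
      · have := abs_le.1 (h.2 k hk)
        constructor <;> linarith [this.1, this.2]
      · exact h.1 k hk
  have hBc : IsCompact B := by
    apply isCompact_univ_pi
    intro k
    split_ifs
    · exact isCompact_Icc
    · exact isCompact_singleton
  have hBn : B.Nonempty := by
    refine ⟨fun k => if G.Adj r k then θ else 0, (hBmem _).2 ⟨fun k hk => by simp [hk],
      fun k hk => ?_⟩⟩
    simp only [hk, if_true, sub_self, abs_zero]; linarith
  obtain ⟨w, hwB, hwmin⟩ := hBc.exists_isMinOn hBn (rlrObj_continuous lam r xs).continuousOn
  have hmin : ∀ v ∈ B, rlrObj lam r w xs ≤ rlrObj lam r v xs := fun v hv => hwmin hv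
  obtain ⟨hw1, hw2⟩ := (hBmem w).1 hwB
  have hest : ∀ v ∈ B, ∀ j, j ≠ r →
      |grad r v xs j - (if G.Adj r j then v j - θ else 0)| ≤ 3 / 8 * lam := by
    intro v hv j hj
    obtain ⟨h1, h2⟩ := (hBmem v).1 hv
    exact main_est hn G Δ hΔ θ lam hθ hK hl0 hl xs hW hM r v (fun k _ => h1 k) h2 j hj
  have hupd : ∀ k t, G.Adj r k → |w k + t - θ| ≤ 2 * lam →
      Function.update w k (w k + t) ∈ B := by
    intro k t hk ht
    rw [hBmem]
    refine ⟨fun i hi => ?_, fun i hi => ?_⟩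
    · have : i ≠ k := fun h => hi (h ▸ hk)
      rw [Function.update_of_ne this]; exact hw1 i hi
    · by_cases h : i = k
      · subst h; rw [Function.update_self]; exact ht
      · rw [Function.update_of_ne h]; exact hw2 i hi
  -- interior
  have hint : ∀ k, G.Adj r k → |w k - θ| < 2 * lam := by
    intro k hk
    have hkr : k ≠ r := hk.ne'
    refine lt_of_le_of_ne (hw2 k hk) fun heq => ?_
    rcases (abs_eq (by linarith)).1 heq with h | h
    · have hin : Function.update w k (w k + (-(lam / 4))) ∈ B :=
        hupd k _ hk (by rw [abs_le]; constructor <;> linarith)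
      have h1 := hmin _ hin
      have h2 := move lam r w xs k hkr (-(lam / 4))
      have h3 := hest _ hin k hkr
      rw [if_pos hk, Function.update_self, abs_le] at h3
      rw [abs_of_pos (show 0 < w k + -(lam / 4) by linarith),
        abs_of_pos (show 0 < w k by linarith)] at h2
      nlinarith [h3.1, h3.2]
    · have hin : Function.update w k (w k + lam / 4) ∈ B :=
        hupd k _ hk (by rw [abs_le]; constructor <;> linarith)
      have h1 := hmin _ hin
      have h2 := move lam r w xs k hkr (lam / 4)
      have h3 := hest _ hin k hkr
      rw [if_pos hk, Function.update_self, abs_le] at h3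
      rw [abs_of_pos (show 0 < w k + lam / 4 by linarith),
        abs_of_pos (show 0 < w k by linarith)] at h2
      nlinarith [h3.1, h3.2]
  have hpos : ∀ k, G.Adj r k → 0 < w k := by
    intro k hk
    have := abs_lt.1 (hint k hk)
    linarith [this.1]
  -- stationarity
  have hstat : ∀ k, G.Adj r k → grad r w xs k = - lam := by
    intro k hk
    have hkr : k ≠ r := hk.ne'
    have hd := pseudoLik_hasDeriv r w xs k hkr
    have hd2 : HasDerivAt (fun t : ℝ => pseudoLik r (Function.update w k (w k + t)) xs + lam * t)
        (grad r w xs k + lam) 0 := by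
      simpa using hd.fun_add ((hasDerivAt_id (0 : ℝ)).const_mul lam)
    have hloc : IsLocalMin
        (fun t : ℝ => pseudoLik r (Function.update w k (w k + t)) xs + lam * t) 0 := by
      have hc : ∀ᶠ t : ℝ in nhds 0, |w k + t - θ| < 2 * lam := by
        have : ContinuousAt (fun t : ℝ => |w k + t - θ|) 0 := by fun_prop
        apply this.eventually_lt continuousAt_const
        simpa using hint k hk
      filter_upwards [hc] with t ht
      have h1 := hmin _ (hupd k t hk ht.le)
      rw [rlrObj_def', rlrObj_def', abs_update r w k hkr] at h1
      have h2 := abs_lt.1 ht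
      rw [abs_of_pos (show 0 < w k + t by linarith [h2.1]), abs_of_pos (hpos k hk)] at h1
      simp only [add_zero, Function.update_eq_self, mul_zero]
      linarith
    have := hloc.hasDerivAt_eq_zero hd2
    linarith
  have hdual : ∀ k, k ≠ r → ¬ G.Adj r k → |grad r w xs k| ≤ 3 / 8 * lam := by
    intro k hkr hk
    have := hest w hwB k hkr
    rwa [if_neg hk, sub_zero] at this
  -- termwise lower bound
  have hterm : ∀ (v : Fin p → ℝ) j, j ≠ r →
      0 ≤ grad r w xs j * (v j - w j) + lam * (|v j| - |w j|) := by
    intro v j hj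
    by_cases hk : G.Adj r j
    · rw [hstat j hk, abs_of_pos (hpos j hk)]
      nlinarith [le_abs_self (v j)]
    · rw [hw1 j hk, abs_zero]
      have h1 := hdual j hj hk
      have h2 : |grad r w xs j * v j| ≤ 3 / 8 * lam * |v j| := by
        rw [abs_mul]; gcongr
      have := (abs_le.1 h2).1
      nlinarith [abs_nonneg (v j)]
  have hsumeq : ∀ v : Fin p → ℝ, ∑ j ∈ Finset.univ.erase r,
      (grad r w xs j * (v j - w j) + lam * (|v j| - |w j|)) =
      ∑ j ∈ Finset.univ.erase r, grad r w xs j * (v j - w j)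
      + (lam * ∑ j ∈ Finset.univ.erase r, |v j| - lam * ∑ j ∈ Finset.univ.erase r, |w j|) := by
    intro v
    rw [Finset.sum_add_distrib, ← Finset.mul_sum, Finset.sum_sub_distrib]
    ring
  have hglob : IsRlrMin lam r xs w := by
    intro v
    have h1 := pseudoLik_tangent r w v xs
    have h2 := hsumeq v
    have h3 : 0 ≤ ∑ j ∈ Finset.univ.erase r,
      (grad r w xs j * (v j - w j) + lam * (|v j| - |w j|)) :=
      Finset.sum_nonneg fun j hj => hterm v j (Finset.ne_of_mem_erase hj)
    rw [rlrObj_def', rlrObj_def']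
    linarith
  refine ⟨⟨w, hglob⟩, fun v hv => ?_⟩
  have hle := hv w
  rw [rlrObj_def', rlrObj_def'] at hle
  have h1 := pseudoLik_tangent r w v xs
  have h2 := hsumeq v
  have h3 : 0 ≤ ∑ j ∈ Finset.univ.erase r,
      (grad r w xs j * (v j - w j) + lam * (|v j| - |w j|)) :=
      Finset.sum_nonneg fun j hj => hterm v j (Finset.ne_of_mem_erase hj)
  have h4 := pseudoLik_tangent_eq hn r w v xs (by linarith)
  have h5 : ∀ j ∈ Finset.univ.erase r,
      grad r w xs j * (v j - w j) + lam * (|v j| - |w j|) = 0 :=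
    (Finset.sum_eq_zero_iff_of_nonneg
      (fun j hj => hterm v j (Finset.ne_of_mem_erase hj))).1 (le_antisymm (by linarith) h3)
  have hv0 : ∀ k, k ≠ r → ¬ G.Adj r k → v k = 0 := by
    intro k hkr hk
    have h6 := h5 k (by simp [hkr])
    rw [hw1 k hk, abs_zero] at h6
    have h7 := hdual k hkr hk
    have h8 : |grad r w xs k * v k| ≤ 3 / 8 * lam * |v k| := by
      rw [abs_mul]; gcongr
    have h9 := (abs_le.1 h8).1
    have : |v k| ≤ 0 := by nlinarith [abs_nonneg (v k)]
    exact abs_eq_zero.1 (le_antisymm this (abs_nonneg _))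
  set N := G.neighborFinset r with hN
  have hmem : ∀ k, k ∈ N ↔ G.Adj r k := fun k => by rw [hN, SimpleGraph.mem_neighborFinset]
  have hNc : N.card ≤ Δ := by rw [hN, G.card_neighborFinset_eq_degree]; exact hΔ r
  have hvw : ∀ k, G.Adj r k → v k = w k := by
    intro k0 hk0
    obtain ⟨k, hkN, hmax⟩ := Finset.exists_max_image N (fun k => |v k - w k|) ⟨k0, (hmem k0).2 hk0⟩
    have h6 := offdiag hn xs Δ hM N hNc (fun k => v k - w k) (|v k - w k|) (abs_nonneg _)
      (fun i hi => hmax i hi) k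
    rw [← av_lin, if_pos hkN] at h6
    have h7 : ∀ l, ∑ k ∈ N, (v k - w k) * spin (xs l k) = 0 := by
      intro l
      have := h4 l
      rw [lin_supp G r v hv0, lin_supp G r w (fun k _ => hw1 k), ← hN] at this
      simp only [sub_mul, Finset.sum_sub_distrib]
      linarith
    simp only [h7, mul_zero] at h6
    have h8 : av (fun _ : Fin n => (0 : ℝ)) = 0 := by simp [av]
    rw [h8, zero_sub, abs_neg] at h6
    have h9 := hmax k0 ((hmem k0).2 hk0)
    have : |v k0 - w k0| ≤ 0 := by linarith [abs_nonneg (v k - w k)]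
    have := abs_eq_zero.1 (le_antisymm this (abs_nonneg _))
    linarith
  intro j hj
  constructor
  · intro h
    by_contra hk
    rw [hv0 j hj hk] at h
    exact lt_irrefl _ h
  · intro hk
    rw [hvw j hk]; exact hpos j hk

def fld {p : ℕ} (G : SimpleGraph (Fin p)) [DecidableRel G.Adj] (θ : ℝ) (j : Fin p)
    (x : Fin p → Bool) : ℝ := ∑ i ∈ G.neighborFinset j, θ * spin (x i)

lemma fld_update {p : ℕ} (G : SimpleGraph (Fin p)) [DecidableRel G.Adj] (θ : ℝ) (j : Fin p)
    (x : Fin p → Bool) (b : Bool) : fld G θ j (Function.update x j b) = fld G θ j x := by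
  unfold fld
  apply Finset.sum_congr rfl
  intro i hi
  rw [SimpleGraph.mem_neighborFinset] at hi
  rw [Function.update_of_ne hi.ne']

open scoped Classical in
lemma weight_split {p : ℕ} (G : SimpleGraph (Fin p)) [DecidableRel G.Adj] (θ : ℝ) (j : Fin p) :
    ∃ R : (Fin p → Bool) → ℝ, (∀ x b, R (Function.update x j b) = R x) ∧
      ∀ x, isingWeight G θ x = Real.exp (spin (x j) * fld G θ j x) * R x := by
  set F : (Fin p → Bool) → Sym2 (Fin p) → ℝ := fun x =>
    Sym2.lift ⟨fun i j => Real.exp (θ * spin (x i) * spin (x j)),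
      fun i j => by show rexp _ = rexp _; rw [mul_right_comm]⟩ with hF
  have hFs : ∀ x a b, F x s(a, b) = Real.exp (θ * spin (x a) * spin (x b)) := fun x a b => rfl
  set E : Finset (Sym2 (Fin p)) := Finset.univ.filter (fun e => e ∈ G.edgeSet) with hE
  have hw : ∀ x, isingWeight G θ x = ∏ e ∈ E, F x e := by
    intro x
    unfold isingWeight
    apply Finset.prod_congr
    · ext e; simp [hE]
    · intro e _; rfl
  refine ⟨fun x => ∏ e ∈ E.filter (fun e => ¬ j ∈ e), F x e, ?_, ?_⟩
  · intro x b
    apply Finset.prod_congr rfl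
    intro e he
    have hje := (Finset.mem_filter.1 he).2
    induction e using Sym2.ind with
    | _ a c =>
      rw [Sym2.mem_iff, not_or] at hje
      rw [hFs, hFs, Function.update_of_ne (Ne.symm hje.1), Function.update_of_ne (Ne.symm hje.2)]
  · intro x
    rw [hw, ← Finset.prod_filter_mul_prod_filter_not E (fun e => j ∈ e)]
    congr 1
    have himg : E.filter (fun e => j ∈ e) = (G.neighborFinset j).image (fun i => s(j, i)) := by
      ext e
      simp only [hE, Finset.mem_filter, Finset.mem_univ, true_and, Finset.mem_image,
        SimpleGraph.mem_neighborFinset]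
      constructor
      · rintro ⟨h1, h2⟩
        obtain ⟨i, rfl⟩ := h2
        exact ⟨i, h1, rfl⟩
      · rintro ⟨i, h1, rfl⟩
        exact ⟨h1, Sym2.mem_mk_left _ _⟩
    rw [himg, Finset.prod_image (by
      intro a _ b _ h
      have h' : s(j, a) = s(j, b) := h
      exact Sym2.congr_right.1 h')]
    simp only [hFs]
    rw [← Real.exp_sum, fld, Finset.mul_sum]
    congr 1
    apply Finset.sum_congr rfl; intro i _; ring

lemma weight_pos {p : ℕ} (G : SimpleGraph (Fin p)) (θ : ℝ) (x : Fin p → Bool) :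
    0 < isingWeight G θ x := by
  unfold isingWeight
  apply Finset.prod_pos
  intro e _
  induction e using Sym2.ind with
  | _ a c => exact Real.exp_pos _

lemma prob_nonneg {p : ℕ} (G : SimpleGraph (Fin p)) (θ : ℝ) (x : Fin p → Bool) :
    0 ≤ isingProb G θ x :=
  div_nonneg (weight_pos G θ x).le (Finset.sum_nonneg fun y _ => (weight_pos G θ y).le)

lemma prob_sum {p : ℕ} (G : SimpleGraph (Fin p)) (θ : ℝ) : ∑ x, isingProb G θ x = 1 := by
  unfold isingProb
  rw [← Finset.sum_div]
  apply div_self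
  exact (Finset.sum_pos (fun y _ => weight_pos G θ y) Finset.univ_nonempty).ne'

def Y {p : ℕ} (G : SimpleGraph (Fin p)) [DecidableRel G.Adj] (θ : ℝ) (j k : Fin p)
    (x : Fin p → Bool) : ℝ := spin (x k) * (spin (x j) - Real.tanh (fld G θ j x))

lemma abs_Y {p : ℕ} (G : SimpleGraph (Fin p)) [DecidableRel G.Adj] (θ : ℝ) (j k : Fin p)
    (x : Fin p → Bool) : |Y G θ j k x| ≤ 2 := by
  unfold Y
  rw [abs_mul, abs_spin, one_mul]
  have h1 := Real.abs_tanh_lt_one (fld G θ j x)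
  have h2 := abs_spin (x j)
  have h3 := abs_sub (spin (x j)) (Real.tanh (fld G θ j x))
  linarith

lemma weight_Y {p : ℕ} (G : SimpleGraph (Fin p)) [DecidableRel G.Adj] (θ : ℝ) (j k : Fin p)
    (hk : k ≠ j) : ∑ x, isingWeight G θ x * Y G θ j k x = 0 := by
  obtain ⟨R, hR1, hR2⟩ := weight_split G θ j
  have hinv : Function.Involutive (fun x : Fin p → Bool => Function.update x j (!(x j))) := by
    intro x; simp
  have h1 := Equiv.sum_comp (hinv.toPerm _) (fun x => isingWeight G θ x * Y G θ j k x)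
  have h2 : ∀ x, isingWeight G θ x * Y G θ j k x +
      isingWeight G θ (hinv.toPerm _ x) * Y G θ j k (hinv.toPerm _ x) = 0 := by
    intro x
    have e : hinv.toPerm _ x = Function.update x j (!(x j)) := rfl
    rw [e, hR2, hR2, hR1]
    unfold Y
    rw [fld_update, Function.update_self, Function.update_of_ne hk, Real.tanh_eq_sinh_div_cosh]
    have hc := (Real.cosh_pos (fld G θ j x)).ne'
    generalize fld G θ j x = h at *
    have key : Real.exp h * (Real.cosh h - Real.sinh h) =
        Real.exp (-h) * (Real.cosh h + Real.sinh h) := by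
      rw [Real.cosh_sub_sinh, Real.cosh_add_sinh, mul_comm]
    cases x j
    · simp only [spin, Bool.not_false, if_true, Bool.false_eq_true, if_false, neg_mul, one_mul]
      field_simp
      linear_combination (R x * if x k = true then (1 : ℝ) else -1) * key
    · simp only [spin, Bool.not_true, if_true, Bool.false_eq_true, if_false, neg_mul, one_mul]
      field_simp
      linear_combination (R x * if x k = true then (1 : ℝ) else -1) * key
  have h3 := Finset.sum_eq_zero (s := Finset.univ) (fun x _ => h2 x)
  rw [Finset.sum_add_distrib, h1] at h3
  linarith

lemma prob_Y {p : ℕ} (G : SimpleGraph (Fin p)) [DecidableRel G.Adj] (θ : ℝ) (j k : Fin p)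
    (hk : k ≠ j) : ∑ x, isingProb G θ x * Y G θ j k x = 0 := by
  unfold isingProb
  simp only [div_mul_eq_mul_div]
  rw [← Finset.sum_div, weight_Y G θ j k hk, zero_div]

lemma mgf {p : ℕ} (G : SimpleGraph (Fin p)) [DecidableRel G.Adj] (θ : ℝ) (j k : Fin p)
    (hk : k ≠ j) (s : ℝ) (hs : |s| ≤ 1 / 2) :
    ∑ x, isingProb G θ x * Real.exp (s * Y G θ j k x) ≤ Real.exp (4 * s ^ 2) := by
  calc _ ≤ ∑ x, isingProb G θ x * (1 + s * Y G θ j k x + 4 * s ^ 2) := by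
        apply Finset.sum_le_sum; intro x _
        apply mul_le_mul_of_nonneg_left _ (prob_nonneg G θ x)
        have hY := abs_Y G θ j k x
        have h1 : |s * Y G θ j k x| ≤ 1 := by
          rw [abs_mul]
          nlinarith [abs_nonneg s, abs_nonneg (Y G θ j k x)]
        have h2 := (abs_le.1 (Real.abs_exp_sub_one_sub_id_le h1)).2
        have h3 : (Y G θ j k x) ^ 2 ≤ 4 := by
          rw [← sq_abs]; nlinarith [abs_nonneg (Y G θ j k x)]
        nlinarith [sq_nonneg s]
    _ = (1 + 4 * s ^ 2) * ∑ x, isingProb G θ x + s * ∑ x, isingProb G θ x * Y G θ j k x := by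
        rw [Finset.mul_sum, Finset.mul_sum, ← Finset.sum_add_distrib]
        apply Finset.sum_congr rfl; intro x _; ring
    _ = 4 * s ^ 2 + 1 := by rw [prob_sum, prob_Y G θ j k hk]; ring
    _ ≤ _ := Real.add_one_le_exp _

lemma mgf_n {p : ℕ} (G : SimpleGraph (Fin p)) [DecidableRel G.Adj] (θ : ℝ) (j k : Fin p)
    (hk : k ≠ j) (s : ℝ) (hs : |s| ≤ 1 / 2) (n : ℕ) :
    ∑ xs : Fin n → Fin p → Bool, Real.exp (s * ∑ l, Y G θ j k (xs l)) * ∏ l, isingProb G θ (xs l)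
      ≤ Real.exp (n * (4 * s ^ 2)) := by
  calc _ = ∑ xs : Fin n → Fin p → Bool,
          ∏ l, (isingProb G θ (xs l) * Real.exp (s * Y G θ j k (xs l))) := by
        apply Finset.sum_congr rfl; intro xs _
        rw [Finset.mul_sum, Real.exp_sum, Finset.prod_mul_distrib, mul_comm]
    _ = (∑ x, isingProb G θ x * Real.exp (s * Y G θ j k x)) ^ n := by
        rw [Fintype.sum_pow]
    _ ≤ (Real.exp (4 * s ^ 2)) ^ n := by
        apply pow_le_pow_left₀ _ (mgf G θ j k hk s hs)
        exact Finset.sum_nonneg fun x _ => mul_nonneg (prob_nonneg G θ x) (Real.exp_pos _).le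
    _ = _ := by rw [← Real.exp_nat_mul]

lemma union_bound {p n : ℕ} (hn : 0 < n) (G : SimpleGraph (Fin p)) [DecidableRel G.Adj] (θ η : ℝ)
    (hη0 : 0 < η) (hη : η ≤ 4) (A : Set (Fin n → Fin p → Bool))
    (hA : ∀ xs, (∀ j k, k ≠ j → |res G θ xs j k| ≤ η) → xs ∈ A) :
    1 - p ^ 2 * (2 * Real.exp (-(n * η ^ 2 / 16))) ≤ sampleProb G θ n A := by
  set t := η / 8 with ht
  set f : (Fin n → Fin p → Bool) → Fin p → Fin p → ℝ := fun xs j k =>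
    if k ≠ j then Real.exp (-(t * (n * η))) * (Real.exp (t * ∑ l, Y G θ j k (xs l)) +
      Real.exp ((-t) * ∑ l, Y G θ j k (xs l))) else 0 with hf
  have hf0 : ∀ xs j k, 0 ≤ f xs j k := by
    intro xs j k
    simp only [hf]
    split_ifs <;> positivity
  have hnp : (0 : ℝ) < n := by exact_mod_cast hn
  have hpt : ∀ xs, 1 - ∑ j, ∑ k, f xs j k ≤ A.indicator (fun _ => (1 : ℝ)) xs := by
    intro xs
    by_cases hx : xs ∈ A
    · rw [Set.indicator_of_mem hx]
      have : 0 ≤ ∑ j, ∑ k, f xs j k :=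
        Finset.sum_nonneg fun j _ => Finset.sum_nonneg fun k _ => hf0 xs j k
      linarith
    · rw [Set.indicator_of_notMem hx]
      have : ¬ ∀ j k, k ≠ j → |res G θ xs j k| ≤ η := fun h => hx (hA xs h)
      push Not at this
      obtain ⟨j, k, hkj, hlt⟩ := this
      have h1 : f xs j k ≤ ∑ j, ∑ k, f xs j k := by
        refine (Finset.single_le_sum (f := fun k => f xs j k) (fun k _ => hf0 xs j k)
          (Finset.mem_univ k)).trans ?_
        exact Finset.single_le_sum (f := fun j => ∑ k, f xs j k)
          (fun j _ => Finset.sum_nonneg fun k _ => hf0 xs j k) (Finset.mem_univ j)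
      have h2 : 1 ≤ f xs j k := by
        simp only [hf, if_pos hkj]
        have hres : res G θ xs j k = (∑ l, Y G θ j k (xs l)) / n := rfl
        rw [hres, abs_div, abs_of_pos hnp, lt_div_iff₀ hnp] at hlt
        rw [mul_add, ← Real.exp_add, ← Real.exp_add]
        have htp : 0 < t := by rw [ht]; linarith
        rcases lt_abs.1 hlt with h | h
        · have h3 : 1 ≤ Real.exp (-(t * (n * η)) + t * ∑ l, Y G θ j k (xs l)) := by
            apply Real.one_le_exp
            nlinarith
          have := Real.exp_pos (-(t * (n * η)) + -t * ∑ l, Y G θ j k (xs l))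
          linarith
        · have h3 : 1 ≤ Real.exp (-(t * (n * η)) + -t * ∑ l, Y G θ j k (xs l)) := by
            apply Real.one_le_exp
            nlinarith
          have := Real.exp_pos (-(t * (n * η)) + t * ∑ l, Y G θ j k (xs l))
          linarith
      linarith
  have hPn : ∀ xs : Fin n → Fin p → Bool, 0 ≤ ∏ l, isingProb G θ (xs l) :=
    fun xs => Finset.prod_nonneg fun l _ => prob_nonneg G θ _
  have hP1 : ∑ xs : Fin n → Fin p → Bool, ∏ l, isingProb G θ (xs l) = 1 := by
    rw [← Fintype.sum_pow, prob_sum, one_pow]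
  have hb : ∀ j k, ∑ xs : Fin n → Fin p → Bool, f xs j k * ∏ l, isingProb G θ (xs l) ≤
      2 * Real.exp (-(n * η ^ 2 / 16)) := by
    intro j k
    by_cases hkj : k ≠ j
    · simp only [hf, if_pos hkj]
      have m1 := mgf_n G θ j k hkj t (by rw [abs_le]; constructor <;> linarith) n
      have m2 := mgf_n G θ j k hkj (-t) (by rw [abs_le]; constructor <;> linarith) n
      have e : Real.exp (-(n * η ^ 2 / 16)) =
          Real.exp (-(t * (n * η))) * Real.exp (n * (4 * t ^ 2)) := by
        rw [← Real.exp_add]; congr 1; rw [ht]; ring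
      rw [e]
      simp only [mul_assoc, add_mul]
      rw [← Finset.mul_sum, Finset.sum_add_distrib]
      rw [neg_sq] at m2
      have := Real.exp_pos (-(t * (n * η)))
      nlinarith
    · simp only [hf, if_neg hkj, zero_mul, Finset.sum_const_zero]
      positivity
  calc 1 - (p : ℝ) ^ 2 * (2 * Real.exp (-(n * η ^ 2 / 16)))
      = 1 - ∑ j : Fin p, ∑ k : Fin p, 2 * Real.exp (-(n * η ^ 2 / 16)) := by
        simp; ring
    _ ≤ 1 - ∑ j : Fin p, ∑ k : Fin p,
          ∑ xs : Fin n → Fin p → Bool, f xs j k * ∏ l, isingProb G θ (xs l) := by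
        gcongr with j _ k _
        exact hb j k
    _ = ∑ xs : Fin n → Fin p → Bool, (1 - ∑ j, ∑ k, f xs j k) * ∏ l, isingProb G θ (xs l) := by
        simp only [sub_mul, one_mul, Finset.sum_mul]
        rw [Finset.sum_sub_distrib, hP1]
        congr 1
        conv_rhs => rw [Finset.sum_comm]
        apply Finset.sum_congr rfl; intro j _
        rw [Finset.sum_comm]
    _ ≤ _ := by
        unfold sampleProb
        apply Finset.sum_le_sum; intro xs _
        exact mul_le_mul_of_nonneg_right (hpt xs) (hPn xs)

end RlrAux

/-- Theorem 5 of the paper. There are numerical constants `K₁, K₂, K₃` such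
that, for any graph `G` of maximum degree at most `Δ ≥ 3` and `0 < θ ≤ K₁/Δ`, with
`λ = K₃ θ Δ^{-1/2}`, if `n ≥ K₂ θ^{-2} Δ log (8p²/δ)`, then `Rlr(λ)` reconstructs `G`
exactly with probability at least `1 - δ`. -/
theorem rlr_success :
    ∃ K₁ K₂ K₃ : ℝ, 0 < K₁ ∧ 0 < K₂ ∧ 0 < K₃ ∧
      ∀ (p : ℕ) (G : SimpleGraph (Fin p)) [DecidableRel G.Adj] (Δ : ℕ),
        3 ≤ Δ → (∀ v, G.degree v ≤ Δ) →
        ∀ θ : ℝ, 0 < θ → θ ≤ K₁ / Δ →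
          ∀ δ : ℝ, δ ∈ Set.Ioo (0 : ℝ) 1 →
            ∀ n : ℕ, K₂ * θ⁻¹ ^ 2 * Δ * Real.log (8 * p ^ 2 / δ) ≤ n →
              1 - δ ≤ sampleProb G θ n
                {xs | rlrSuccessStrong (K₃ * θ / Real.sqrt Δ) xs G} := by
  refine ⟨1 / 100, 16384, 1 / 4, by norm_num, by norm_num, by norm_num, ?_⟩
  intro p G _ Δ hΔ3 hdeg θ hθ hθK δ hδ n hn
  obtain ⟨hδ0, hδ1⟩ := hδ
  rcases Nat.eq_zero_or_pos p with hp | hp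
  · subst hp
    have hall : {xs : Fin n → Fin 0 → Bool |
        rlrSuccessStrong (1 / 4 * θ / Real.sqrt Δ) xs G} = Set.univ := by
      ext xs
      simp only [Set.mem_ofPred_eq, Set.mem_univ, iff_true]
      intro r; exact r.elim0
    rw [hall]
    unfold sampleProb
    simp only [Set.indicator_univ, one_mul]
    rw [← Fintype.sum_pow, RlrAux.prob_sum, one_pow]
    linarith
  have hΔ : (3 : ℝ) ≤ Δ := by exact_mod_cast hΔ3
  have hpR : (1 : ℝ) ≤ p := by exact_mod_cast hp
  have hΔ0 : (0 : ℝ) < Δ := by linarith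
  have harg : 1 < 8 * (p : ℝ) ^ 2 / δ := by
    rw [lt_div_iff₀ hδ0]; nlinarith
  have hlog : 0 < Real.log (8 * (p : ℝ) ^ 2 / δ) := Real.log_pos harg
  have hnR : (0 : ℝ) < n := by
    refine lt_of_lt_of_le ?_ hn
    positivity
  have hn0 : 0 < n := by exact_mod_cast hnR
  have hK : θ * Δ ≤ 1 / 100 := by rwa [le_div_iff₀ hΔ0] at hθK
  have hs1 : 1 ≤ Real.sqrt Δ := by
    rw [Real.one_le_sqrt]; linarith
  have hs0 : 0 < Real.sqrt Δ := by linarith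
  set lam := 1 / 4 * θ / Real.sqrt Δ with hlam
  have hl0 : 0 < lam := by positivity
  have hl : lam ≤ θ / 4 := by
    rw [hlam, div_le_iff₀ hs0]; nlinarith
  have hθ1 : θ ≤ 1 := by nlinarith
  have hub := RlrAux.union_bound hn0 G θ (lam / 8) (by positivity) (by linarith)
    {xs | rlrSuccessStrong lam xs G}
    (fun xs h => RlrAux.determ hn0 G Δ hdeg θ lam hθ hK hl0 hl xs h)
  refine le_trans ?_ hub
  have hexp : Real.log (8 * (p : ℝ) ^ 2 / δ) ≤ n * (lam / 8) ^ 2 / 16 := by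
    have hsq : lam ^ 2 = θ ^ 2 / (16 * Δ) := by
      rw [hlam, div_pow, Real.sq_sqrt hΔ0.le, mul_pow]
      field_simp
      norm_num
    have e : (n : ℝ) * (lam / 8) ^ 2 / 16 = n * (θ ^ 2 / (16384 * Δ)) := by
      rw [div_pow, hsq]
      field_simp
      norm_num
    rw [e]
    calc Real.log (8 * (p : ℝ) ^ 2 / δ)
        = (16384 * θ⁻¹ ^ 2 * Δ * Real.log (8 * p ^ 2 / δ)) * (θ ^ 2 / (16384 * Δ)) := by
          field_simp
      _ ≤ _ := by gcongr
  have h1 : Real.exp (-(n * (lam / 8) ^ 2 / 16)) ≤ δ / (8 * p ^ 2) := by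
    calc _ ≤ Real.exp (-Real.log (8 * (p : ℝ) ^ 2 / δ)) := by
          apply Real.exp_le_exp.2; linarith
      _ = _ := by
          rw [Real.exp_neg, Real.exp_log (by linarith), inv_div]
  have h2 : (p : ℝ) ^ 2 * (2 * Real.exp (-(n * (lam / 8) ^ 2 / 16))) ≤ δ := by
    calc _ ≤ (p : ℝ) ^ 2 * (2 * (δ / (8 * p ^ 2))) := by gcongr
      _ = δ / 4 := by field_simp; norm_num
      _ ≤ δ := by linarith
  linarith

end
end
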